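/- Assume μ > rc, 0 ≤ l < c, and R ≥ p. Let n̲ = ⌊r(R−p)/ln(μ/(μ−rc))⌋ and n̄ = ⌊r(R−p)/ln(μ/(μ−r(c−l)))⌋. Then for every sequence of nonnegative lead-time quotes d : ℕ → [0,∞), the set {n ∈ ℕ : B_n(d_n) < 0} is nonempty, and its least element n₀ (the balking threshold induced by the quotation policy) satisfies n̲ ≤ n₀ ≤ n̄. -/

import Mathlib

open MeasureTheory

/-- Density of the Gamma(n+1, μ) distribution: f_{n,μ}(x) = μ^{n+1} x^n e^{-μx} / n!. -/
noncomputable def gpdf (n : ℕ) (μ x : ℝ) : ℝ :=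
  μ ^ (n + 1) * x ^ n * Real.exp (-(μ * x)) / (n.factorial : ℝ)

/-- Expected CARA utility of a customer quoted lead-time `d` who joins when `n`
customers are present. -/
noncomputable def Bn (R p c l r μ : ℝ) (n : ℕ) (d : ℝ) : ℝ :=
  (∫ x in (0:ℝ)..d, (1 - Real.exp (-(r * (R - p - c * x)))) / r * gpdf n μ x)
  + ∫ x in Set.Ioi d,
      (1 - Real.exp (-(r * (R - p - l * d - (c - l) * x)))) / r * gpdf n μ x

theorem gpdf_nonneg (n : ℕ) {μ x : ℝ} (hμ : 0 ≤ μ) (hx : 0 ≤ x) : 0 ≤ gpdf n μ x := by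
  unfold gpdf
  positivity

theorem integrableOn_gpdf (n : ℕ) {μ : ℝ} (hμ : 0 < μ) :
    IntegrableOn (gpdf n μ) (Set.Ioi 0) := by
  have h := integrableOn_rpow_mul_exp_neg_mul_rpow (p := 1) (s := n) (b := μ)
    (by linarith [n.cast_nonneg (α := ℝ)]) one_pos hμ
  refine IntegrableOn.congr_fun (h.const_mul (μ ^ (n + 1) / (n.factorial : ℝ)))
    (fun x _ => ?_) measurableSet_Ioi
  simp only [gpdf, Real.rpow_natCast, Real.rpow_one, neg_mul]
  ring

theorem integral_gpdf (n : ℕ) {μ : ℝ} (hμ : 0 < μ) :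
    ∫ x in Set.Ioi 0, gpdf n μ x = 1 := by
  have h := Real.integral_rpow_mul_exp_neg_mul_Ioi (a := n + 1) (r := μ) (by positivity) hμ
  have e : ∀ x, gpdf n μ x = μ ^ (n + 1) / (n.factorial : ℝ) *
      (x ^ ((n : ℝ) + 1 - 1) * Real.exp (-(μ * x))) := by
    intro x
    rw [add_sub_cancel_right, Real.rpow_natCast, gpdf]
    ring
  simp_rw [e]
  rw [integral_const_mul, h, Real.Gamma_nat_eq_factorial]
  have hn : (n.factorial : ℝ) ≠ 0 := by positivity
  have e2 : (1 / μ) ^ ((n : ℝ) + 1) = (1 / μ) ^ (n + 1) := by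
    exact_mod_cast Real.rpow_natCast (1 / μ) (n + 1)
  rw [e2, one_div, inv_pow]
  field_simp

/-- Exponential tilting of the Gamma density. -/
theorem exp_mul_gpdf (n : ℕ) {A k r μ : ℝ} (hk : r * k < μ) (x : ℝ) :
    Real.exp (-(r * (A - k * x))) * gpdf n μ x =
      Real.exp (-(r * A)) * (μ / (μ - r * k)) ^ (n + 1) * gpdf n (μ - r * k) x := by
  have h : μ - r * k ≠ 0 := by linarith
  have e : Real.exp (-(r * (A - k * x))) * Real.exp (-(μ * x)) =
      Real.exp (-(r * A)) * Real.exp (-((μ - r * k) * x)) := by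
    rw [← Real.exp_add, ← Real.exp_add]
    ring_nf
  unfold gpdf
  rw [div_pow]
  have hpow := div_mul_cancel₀ (μ ^ (n + 1)) (pow_ne_zero (n + 1) h)
  linear_combination μ ^ (n + 1) * x ^ n / (n.factorial : ℝ) * e -
    Real.exp (-(r * A)) * Real.exp (-((μ - r * k) * x)) * x ^ n / (n.factorial : ℝ) * hpow

theorem utility_mul_gpdf (n : ℕ) {A k r μ : ℝ} (hk : r * k < μ) (x : ℝ) :
    (1 - Real.exp (-(r * (A - k * x)))) / r * gpdf n μ x =
      1 / r * (gpdf n μ x -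
        Real.exp (-(r * A)) * (μ / (μ - r * k)) ^ (n + 1) * gpdf n (μ - r * k) x) := by
  rw [← exp_mul_gpdf n hk]
  ring

theorem integrableOn_utility (n : ℕ) {A k r μ : ℝ} (hμ : 0 < μ) (hk : r * k < μ) :
    IntegrableOn (fun x => (1 - Real.exp (-(r * (A - k * x)))) / r * gpdf n μ x)
      (Set.Ioi 0) := by
  simp_rw [utility_mul_gpdf n hk]
  exact ((integrableOn_gpdf n hμ).sub
    ((integrableOn_gpdf n (sub_pos.2 hk)).const_mul _)).const_mul _

theorem integral_utility (n : ℕ) {A k r μ : ℝ} (hμ : 0 < μ) (hk : r * k < μ) :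
    ∫ x in Set.Ioi 0, (1 - Real.exp (-(r * (A - k * x)))) / r * gpdf n μ x =
      (1 - Real.exp (-(r * A)) * (μ / (μ - r * k)) ^ (n + 1)) / r := by
  simp_rw [utility_mul_gpdf n hk]
  rw [integral_const_mul, integral_sub (integrableOn_gpdf n hμ)
    ((integrableOn_gpdf n (sub_pos.2 hk)).const_mul _), integral_const_mul,
    integral_gpdf n hμ, integral_gpdf n (sub_pos.2 hk)]
  ring

theorem utility_mul_gpdf_le (n : ℕ) {r μ x a b : ℝ} (hr : 0 < r) (hμ : 0 ≤ μ) (hx : 0 ≤ x)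
    (hab : a ≤ b) :
    (1 - Real.exp (-(r * a))) / r * gpdf n μ x ≤ (1 - Real.exp (-(r * b))) / r * gpdf n μ x := by
  have := gpdf_nonneg n hμ hx
  gcongr

theorem integral_Ioi_zero_eq_add {f : ℝ → ℝ} {d : ℝ} (hd : 0 ≤ d)
    (hf : IntegrableOn f (Set.Ioi 0)) :
    ∫ x in Set.Ioi 0, f x = (∫ x in Set.Ioc 0 d, f x) + ∫ x in Set.Ioi d, f x := by
  rw [← Set.Ioc_union_Ioi_eq_Ioi hd]
  exact setIntegral_union (Set.Ioc_disjoint_Ioi le_rfl) measurableSet_Ioi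
    (hf.mono_set Set.Ioc_subset_Ioi_self) (hf.mono_set (Set.Ioi_subset_Ioi hd))

/-- The expected utility lies between its values without and with full compensation from
time zero. -/
theorem Bn_bounds {R p c l r μ : ℝ} (hc : 0 < c) (hl0 : 0 ≤ l)
    (hr : 0 < r) (hμ : r * c < μ) (n : ℕ) {d : ℝ} (hd : 0 ≤ d) :
    (1 - Real.exp (-(r * (R - p))) * (μ / (μ - r * c)) ^ (n + 1)) / r ≤ Bn R p c l r μ n d ∧
    Bn R p c l r μ n d ≤
      (1 - Real.exp (-(r * (R - p))) * (μ / (μ - r * (c - l))) ^ (n + 1)) / r := by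
  have hμ0 : 0 < μ := (mul_pos hr hc).trans hμ
  have hμl : r * (c - l) < μ := by nlinarith
  have hIoc : Set.Ioc 0 d ⊆ Set.Ioi (0 : ℝ) := Set.Ioc_subset_Ioi_self
  have hIoi : Set.Ioi d ⊆ Set.Ioi (0 : ℝ) := Set.Ioi_subset_Ioi hd
  have i₁ := integrableOn_utility n (A := R - p) hμ0 hμ
  have i₂ := integrableOn_utility n (A := R - p) hμ0 hμl
  have i₃ := integrableOn_utility n (A := R - p - l * d) hμ0 hμl
  rw [← integral_utility n hμ0 hμ, ← integral_utility n hμ0 hμl,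
    integral_Ioi_zero_eq_add hd i₁, integral_Ioi_zero_eq_add hd i₂, Bn,
    intervalIntegral.integral_of_le hd]
  refine ⟨add_le_add le_rfl ?_, add_le_add ?_ ?_⟩
  · refine setIntegral_mono_on (i₁.mono_set hIoi) (i₃.mono_set hIoi) measurableSet_Ioi
      fun x hx => utility_mul_gpdf_le n hr hμ0.le (hIoi hx).le ?_
    nlinarith [Set.mem_Ioi.1 hx]
  · refine setIntegral_mono_on (i₁.mono_set hIoc) (i₂.mono_set hIoc) measurableSet_Ioc
      fun x hx => utility_mul_gpdf_le n hr hμ0.le (hIoc hx).le ?_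
    nlinarith [hx.1]
  · refine setIntegral_mono_on (i₃.mono_set hIoi) (i₂.mono_set hIoi) measurableSet_Ioi
      fun x hx => utility_mul_gpdf_le n hr hμ0.le (hIoi hx).le ?_
    nlinarith

theorem exp_neg_mul_pow_le_one_iff {a q : ℝ} (hq : 1 < q) (n : ℕ) :
    Real.exp (-a) * q ^ n ≤ 1 ↔ (n : ℝ) ≤ a / Real.log q := by
  have hq0 : 0 < q := one_pos.trans hq
  rw [le_div_iff₀ (Real.log_pos hq), ← Real.log_pow,
    Real.log_le_iff_le_exp (pow_pos hq0 n), Real.exp_neg, inv_mul_le_iff₀ (Real.exp_pos a), mul_one]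

/-- Under any nonnegative quotation policy the balking threshold (the least queue length
at which an arriving customer balks) exists and lies between the two explicit bounds. -/
theorem balking_threshold_bounds
    (R p c l r μ : ℝ) (hpR : p ≤ R) (hc : 0 < c) (hl0 : 0 ≤ l) (hlc : l < c)
    (hr : 0 < r) (hμ : r * c < μ) (d : ℕ → ℝ) (hd : ∀ n, 0 ≤ d n) :
    {n : ℕ | Bn R p c l r μ n (d n) < 0}.Nonempty ∧
    Nat.floor (r * (R - p) / Real.log (μ / (μ - r * c))) ≤
      sInf {n : ℕ | Bn R p c l r μ n (d n) < 0} ∧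
    sInf {n : ℕ | Bn R p c l r μ n (d n) < 0} ≤
      Nat.floor (r * (R - p) / Real.log (μ / (μ - r * (c - l)))) := by
  have one_lt_ratio : ∀ k, 0 < k → k ≤ c → 1 < μ / (μ - r * k) := by
    intro k hk hkc
    have h₁ : 0 < r * k := mul_pos hr hk
    have h₂ : r * k ≤ r * c := mul_le_mul_of_nonneg_left hkc hr.le
    rw [one_lt_div (by linarith)]
    linarith
  have hq := one_lt_ratio c hc le_rfl
  have hql := one_lt_ratio (c - l) (by linarith) (by linarith)
  have bounds := fun n => Bn_bounds (R := R) (p := p) hc hl0 hr hμ n (hd n)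
  have mem : Nat.floor (r * (R - p) / Real.log (μ / (μ - r * (c - l)))) ∈
      {n : ℕ | Bn R p c l r μ n (d n) < 0} := by
    refine (bounds _).2.trans_lt (div_neg_of_neg_of_pos (sub_neg.2 ?_) hr)
    rw [← not_le, exp_neg_mul_pow_le_one_iff hql, not_le]
    exact_mod_cast Nat.lt_floor_add_one _
  refine ⟨⟨_, mem⟩, le_csInf ⟨_, mem⟩ fun n hn => ?_, Nat.sInf_le mem⟩
  by_contra! hlt
  refine absurd ((bounds n).1.trans_lt hn) (not_lt.2 (div_nonneg (sub_nonneg.2 ?_) hr.le))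
  rw [exp_neg_mul_pow_le_one_iff hq]
  have hr0 : 0 ≤ r * (R - p) / Real.log (μ / (μ - r * c)) :=
    div_nonneg (mul_nonneg hr.le (sub_nonneg.2 hpR)) (Real.log_pos hq).le
  exact (Nat.le_floor_iff hr0).1 hlt
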